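/- Let f : A → A be a covering map of degree d with |d| > 1. Suppose each end of A is attracting: there exists ε ∈ (0, 1/2) such that, setting U = S¹ × ((0,ε) ∪ (1−ε,1)), the closure in A of f(U) is contained in U. Then f is complete: for every integer n ≥ 1, the map fⁿ has exactly |dⁿ − 1| Nielsen classes of fixed points. -/

import Mathlib

open Set Filter Topology

noncomputable section

/-- The open annulus `A = S¹ × (0,1)`. -/
abbrev Ann : Type := Circle × (Set.Ioo (0:ℝ) 1)

/-- The universal cover `Ã = ℝ × (0,1)`. -/
abbrev AnnTil : Type := ℝ × (Set.Ioo (0:ℝ) 1)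

/-- The covering projection `π(x,y) = (exp(2πix), y)`. -/
def pr : AnnTil → Ann := fun z => (Circle.exp (2 * Real.pi * z.1), z.2)

/-- Translation by an integer in the first coordinate: `z + k`. -/
def tr (z : AnnTil) (k : ℤ) : AnnTil := (z.1 + k, z.2)

/-- `F` is a lift of `f`. -/
def IsLift (f : Ann → Ann) (F : AnnTil → AnnTil) : Prop :=
  Continuous F ∧ pr ∘ F = f ∘ pr

/-- `f` has degree `d`: some lift satisfies `F(z+1) = F(z) + d`. -/
def HasDegree (f : Ann → Ann) (d : ℤ) : Prop :=
  ∃ F : AnnTil → AnnTil, IsLift f F ∧ ∀ z, F (tr z 1) = tr (F z) d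

/-- A subset of the annulus is essential if it is not contained in any
connected, simply connected open subset. -/
def IsEssential (K : Set Ann) : Prop :=
  ¬ ∃ U : Set Ann, IsOpen U ∧ IsConnected U ∧ SimplyConnectedSpace U ∧ K ⊆ U

/-- Nielsen equivalence of fixed points `p`, `q` of `g`: there is a path `γ`
from `p` to `q` homotopic (rel endpoints) to `g ∘ γ`. -/
def NielsenEquiv (g : Ann → Ann) (p q : Ann) : Prop :=
  ∃ (hg : Continuous g) (hp : g p = p) (hq : g q = q) (γ : Path p q),
    γ.Homotopic ((γ.map hg).cast hp.symm hq.symm)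

/-- `g` has exactly `N` Nielsen classes of fixed points. -/
def HasExactlyNielsenClasses (g : Ann → Ann) (N : ℕ) : Prop :=
  ∃ S : Finset Ann, S.card = N ∧ (∀ p ∈ S, g p = p) ∧
    (∀ p ∈ S, ∀ q ∈ S, p ≠ q → ¬ NielsenEquiv g p q) ∧
    (∀ p, g p = p → ∃ q ∈ S, NielsenEquiv g p q)

/-- `Fill K`: the union of `K` with the connected components of its
complement whose closure is compact. -/
def Fill (K : Set Ann) : Set Ann :=
  K ∪ {x | x ∈ Kᶜ ∧ IsCompact (closure (connectedComponentIn Kᶜ x))}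

theorem stay_above {X : Type*} [TopologicalSpace X] {S : Set X} (hS : IsPreconnected S) {θ : X → ℝ}
    (hθ : Continuous θ) {c : ℝ} (hc : ∀ x ∈ S, θ x ≠ c) {p q : X} (hp : p ∈ S) (hq : q ∈ S)
    (h : c < θ p) : c < θ q := by
  by_contra hcon
  push Not at hcon
  obtain ⟨x, hx, hxc⟩ := hS.intermediate_value hq hp hθ.continuousOn ⟨hcon, h.le⟩
  exact hc x hx hxc

theorem no_arg (θ : ℝ × ℝ → ℝ) (hθ : Continuous θ) {a b c d : ℝ} (hab : a ≤ b) (hcd : c ≤ d)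
    (hl : ∀ y ∈ Icc c d, Real.cos (θ (a, y)) < 0)
    (hr : ∀ y ∈ Icc c d, 0 < Real.cos (θ (b, y)))
    (hbo : ∀ x ∈ Icc a b, Real.sin (θ (x, c)) < 0)
    (hto : ∀ x ∈ Icc a b, 0 < Real.sin (θ (x, d)))
    (h1 : Real.pi < θ (a, c)) (h2 : θ (a, c) < 3 * Real.pi / 2) : False := by
  have hpi := Real.pi_pos
  have ca : a ∈ Icc a b := ⟨le_rfl, hab⟩
  have cb : b ∈ Icc a b := ⟨hab, le_rfl⟩
  have cc : c ∈ Icc c d := ⟨le_rfl, hcd⟩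
  have cd : d ∈ Icc c d := ⟨hcd, le_rfl⟩
  have hx (y : ℝ) : Continuous fun x => θ (x, y) := by fun_prop
  have hy (x : ℝ) : Continuous fun y => θ (x, y) := by fun_prop
  have A1 : Real.pi < θ (b, c) := stay_above isPreconnected_Icc (hx c)
    (fun x hx h => by have := hbo x hx; rw [h] at this; simp at this) ca cb h1
  have A2 : 3 * Real.pi / 2 < θ (b, c) := by
    by_contra hcon
    push Not at hcon
    have := Real.cos_nonpos_of_pi_div_two_le_of_le (x := θ (b, c)) (by linarith) (by linarith)
    linarith [hr c cc]
  have e1 : Real.cos (3 * Real.pi / 2) = 0 := by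
    rw [show 3 * Real.pi / 2 = Real.pi / 2 + Real.pi by ring, Real.cos_add_pi]; simp
  have A3 : 3 * Real.pi / 2 < θ (b, d) := stay_above isPreconnected_Icc (hy b)
    (fun x hx h => by have := hr x hx; rw [h, e1] at this; simp at this) cc cd A2
  have A4 : 2 * Real.pi < θ (b, d) := by
    by_contra hcon
    push Not at hcon
    have := Real.sin_nonpos_of_nonpos_of_neg_pi_le (x := θ (b, d) - 2 * Real.pi) (by linarith) (by linarith)
    rw [Real.sin_sub_two_pi] at this
    linarith [hto b cb]
  have A5 : 2 * Real.pi < θ (a, d) := stay_above isPreconnected_Icc (hx d)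
    (fun x hx h => by have := hto x hx; rw [h] at this; simp at this) cb ca A4
  have A6 : 2 * Real.pi + Real.pi / 2 < θ (a, d) := by
    by_contra hcon
    push Not at hcon
    have := Real.cos_nonneg_of_neg_pi_div_two_le_of_le (x := θ (a, d) - 2 * Real.pi) (by linarith) (by linarith)
    rw [Real.cos_sub_two_pi] at this
    linarith [hl d cd]
  have e2 : Real.cos (2 * Real.pi + Real.pi / 2) = 0 := by
    rw [add_comm, Real.cos_add_two_pi]; simp
  have A7 : 2 * Real.pi + Real.pi / 2 < θ (a, c) := stay_above isPreconnected_Icc (hy a)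
    (fun x hx h => by have := hl x hx; rw [h, e2] at this; simp at this) cd cc A6
  linarith

theorem miranda_aux (u v : ℝ × ℝ → ℝ) (hu : Continuous u) (hv : Continuous v)
    (hne : ∀ z, u z ≠ 0 ∨ v z ≠ 0) {a b c d : ℝ} (hab : a ≤ b) (hcd : c ≤ d)
    (hl : ∀ y ∈ Icc c d, u (a, y) < 0)
    (hr : ∀ y ∈ Icc c d, 0 < u (b, y))
    (hbo : ∀ x ∈ Icc a b, v (x, c) < 0)
    (hto : ∀ x ∈ Icc a b, 0 < v (x, d)) : False := by
  let h : C(ℝ × ℝ, {z : ℂ // z ≠ 0}) :=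
    ⟨fun z => ⟨(u z : ℂ) + v z * Complex.I, by
      intro h0
      have hre := congrArg Complex.re h0
      have him := congrArg Complex.im h0
      simp at hre him
      rcases hne z with h | h <;> contradiction⟩, by fun_prop⟩
  obtain ⟨F, ⟨-, hF⟩, -⟩ := Complex.isCoveringMap_exp.existsUnique_continuousMap_lifts h
    ((a, c) : ℝ × ℝ) (Complex.log (h (a, c)).1)
    (by apply Subtype.ext; exact Complex.exp_log (h (a,c)).2)
  have key : ∀ z, Complex.exp (F z) = (u z : ℂ) + v z * Complex.I := fun z =>
    congrArg Subtype.val (congrFun hF z)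
  have ku : ∀ z, u z = Real.exp (F z).re * Real.cos (F z).im := fun z => by
    have := congrArg Complex.re (key z)
    rw [Complex.exp_re] at this; simpa using this.symm
  have kv : ∀ z, v z = Real.exp (F z).re * Real.sin (F z).im := fun z => by
    have := congrArg Complex.im (key z)
    rw [Complex.exp_im] at this; simpa using this.symm
  have hpi := Real.pi_pos
  let k : ℤ := ⌊(F (a,c)).im / (2 * Real.pi)⌋
  let θ : ℝ × ℝ → ℝ := fun z => (F z).im - k * (2 * Real.pi)
  have cosθ : ∀ z, Real.cos (θ z) = Real.cos (F z).im := fun z => Real.cos_sub_int_mul_two_pi _ _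
  have sinθ : ∀ z, Real.sin (θ z) = Real.sin (F z).im := fun z => Real.sin_sub_int_mul_two_pi _ _
  have hl' : ∀ y ∈ Icc c d, Real.cos (θ (a, y)) < 0 := fun y hy => by
    have := hl y hy
    rw [ku] at this; rw [cosθ]; exact (pos_iff_neg_of_mul_neg this).1 (Real.exp_pos _)
  have hr' : ∀ y ∈ Icc c d, 0 < Real.cos (θ (b, y)) := fun y hy => by
    have := hr y hy
    rw [ku] at this; rw [cosθ]; exact (pos_iff_pos_of_mul_pos this).1 (Real.exp_pos _)
  have hb' : ∀ x ∈ Icc a b, Real.sin (θ (x, c)) < 0 := fun y hy => by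
    have := hbo y hy
    rw [kv] at this; rw [sinθ]; exact (pos_iff_neg_of_mul_neg this).1 (Real.exp_pos _)
  have ht' : ∀ x ∈ Icc a b, 0 < Real.sin (θ (x, d)) := fun y hy => by
    have := hto y hy
    rw [kv] at this; rw [sinθ]; exact (pos_iff_pos_of_mul_pos this).1 (Real.exp_pos _)
  have f1 : 0 ≤ θ (a, c) := by
    have := Int.floor_le ((F (a,c)).im / (2 * Real.pi))
    rw [le_div_iff₀ (by positivity)] at this
    simp only [θ, k]; linarith
  have f2 : θ (a, c) < 2 * Real.pi := by
    have := Int.lt_floor_add_one ((F (a,c)).im / (2 * Real.pi))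
    rw [div_lt_iff₀ (by positivity)] at this
    simp only [θ, k]; linarith
  refine no_arg θ (by fun_prop) hab hcd hl' hr' hb' ht' ?_ ?_
  · by_contra hcon
    push Not at hcon
    linarith [Real.sin_nonneg_of_nonneg_of_le_pi f1 hcon, hb' a ⟨le_rfl, hab⟩]
  · by_contra hcon
    push Not at hcon
    have := Real.cos_nonneg_of_neg_pi_div_two_le_of_le (x := θ (a, c) - 2 * Real.pi) (by linarith) (by linarith)
    rw [Real.cos_sub_two_pi] at this
    linarith [hl' c ⟨le_rfl, hcd⟩]

/-- Poincaré–Miranda in the plane. -/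
theorem miranda (u v : ℝ × ℝ → ℝ) (hu : Continuous u) (hv : Continuous v)
    {a b c d : ℝ} (hab : a ≤ b) (hcd : c ≤ d)
    (hl : ∀ y ∈ Icc c d, u (a, y) < 0)
    (hr : ∀ y ∈ Icc c d, 0 < u (b, y))
    (hbo : ∀ x ∈ Icc a b, v (x, c) < 0)
    (hto : ∀ x ∈ Icc a b, 0 < v (x, d)) :
    ∃ z ∈ Icc a b ×ˢ Icc c d, u z = 0 ∧ v z = 0 := by
  by_contra hcon
  push Not at hcon
  let r : ℝ × ℝ → ℝ × ℝ := fun z => (projIcc a b hab z.1, projIcc c d hcd z.2)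
  have hrc : Continuous r := by
    have := continuous_projIcc (h := hab)
    have := continuous_projIcc (h := hcd)
    fun_prop
  have e1 : ∀ x ∈ Icc a b, ∀ y ∈ Icc c d, r (x, y) = (x, y) := fun x hx y hy => by
    simp only [r, projIcc_of_mem hab hx, projIcc_of_mem hcd hy]
  have ca : a ∈ Icc a b := ⟨le_rfl, hab⟩
  have cb : b ∈ Icc a b := ⟨hab, le_rfl⟩
  have cc : c ∈ Icc c d := ⟨le_rfl, hcd⟩
  have cd : d ∈ Icc c d := ⟨hcd, le_rfl⟩
  refine miranda_aux (u ∘ r) (v ∘ r) (hu.comp hrc) (hv.comp hrc) (fun z => ?_) hab hcd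
    (fun y hy => ?_) (fun y hy => ?_) (fun y hy => ?_) (fun y hy => ?_)
  · by_cases h : u (r z) = 0
    · exact Or.inr (hcon _ ⟨(projIcc a b hab z.1).2, (projIcc c d hcd z.2).2⟩ h)
    · exact Or.inl h
  · rw [Function.comp, e1 _ ca _ hy]; exact hl y hy
  · rw [Function.comp, e1 _ cb _ hy]; exact hr y hy
  · rw [Function.comp, e1 _ hy _ cc]; exact hbo y hy
  · rw [Function.comp, e1 _ hy _ cd]; exact hto y hy

/-- Version allowing either orientation on both pairs of sides. -/
theorem miranda' (u v : ℝ × ℝ → ℝ) (hu : Continuous u) (hv : Continuous v)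
    {a b c d : ℝ} (hab : a ≤ b) (hcd : c ≤ d)
    (h1 : (∀ y ∈ Icc c d, u (a, y) < 0 ∧ 0 < u (b, y)) ∨
      (∀ y ∈ Icc c d, 0 < u (a, y) ∧ u (b, y) < 0))
    (h2 : (∀ x ∈ Icc a b, v (x, c) < 0 ∧ 0 < v (x, d)) ∨
      (∀ x ∈ Icc a b, 0 < v (x, c) ∧ v (x, d) < 0)) :
    ∃ z ∈ Icc a b ×ˢ Icc c d, u z = 0 ∧ v z = 0 := by
  rcases h1 with h1 | h1 <;> rcases h2 with h2 | h2
  · exact miranda u v hu hv hab hcd (fun y hy => (h1 y hy).1) (fun y hy => (h1 y hy).2)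
      (fun y hy => (h2 y hy).1) (fun y hy => (h2 y hy).2)
  · simpa using miranda u (-v) hu hv.neg hab hcd (fun y hy => (h1 y hy).1) (fun y hy => (h1 y hy).2)
      (fun y hy => by simpa using (h2 y hy).1) (fun y hy => by simpa using (h2 y hy).2)
  · simpa using miranda (-u) v hu.neg hv hab hcd (fun y hy => by simpa using (h1 y hy).1)
      (fun y hy => by simpa using (h1 y hy).2)
      (fun y hy => (h2 y hy).1) (fun y hy => (h2 y hy).2)
  · simpa using miranda (-u) (-v) hu.neg hv.neg hab hcd (fun y hy => by simpa using (h1 y hy).1)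
      (fun y hy => by simpa using (h1 y hy).2)
      (fun y hy => by simpa using (h2 y hy).1) (fun y hy => by simpa using (h2 y hy).2)

theorem continuous_pr : Continuous pr := by unfold pr; fun_prop

theorem continuous_tr (k : ℤ) : Continuous fun z => tr z k := by unfold tr; fun_prop

theorem tr_tr (z : AnnTil) (j k : ℤ) : tr (tr z j) k = tr z (j + k) := by
  simp [tr, add_assoc]

theorem tr_zero (z : AnnTil) : tr z 0 = z := by simp [tr]

theorem tr_inj {z : AnnTil} {j k : ℤ} (h : tr z j = tr z k) : j = k := by
  simpa [tr] using h

theorem pr_tr (z : AnnTil) (k : ℤ) : pr (tr z k) = pr z := by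
  refine Prod.ext ?_ rfl
  simp only [pr, tr]
  rw [Circle.exp_eq_exp]
  exact ⟨k, by ring⟩

theorem pr_eq {z w : AnnTil} (h : pr z = pr w) : ∃ m : ℤ, w = tr z m := by
  have h1 := congrArg Prod.fst h
  have h2 := congrArg Prod.snd h
  simp only [pr] at h1 h2
  obtain ⟨m, hm⟩ := Circle.exp_eq_exp.1 h1.symm
  refine ⟨m, Prod.ext ?_ h2.symm⟩
  simp only [tr]
  have hpi : (2 * Real.pi) ≠ 0 := by positivity
  apply mul_left_cancel₀ hpi
  rw [hm]; ring

theorem pr_surj (p : Ann) : ∃ z, pr z = p := by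
  obtain ⟨t, ht⟩ := Circle.exp_surjective p.1
  refine ⟨(t / (2 * Real.pi), p.2), Prod.ext ?_ rfl⟩
  simp only [pr]
  rw [mul_div_cancel₀ _ (by positivity), ht]

theorem deg_int {G : AnnTil → AnnTil} {D : ℤ} (hD : ∀ z, G (tr z 1) = tr (G z) D) (z : AnnTil)
    (k : ℤ) : G (tr z k) = tr (G z) (D * k) := by
  induction k using Int.induction_on with
  | zero => simp [tr_zero]
  | succ n ih =>
    rw [← tr_tr, hD, ih, tr_tr]; congr 1; ring
  | pred n ih =>
    have := hD (tr z (-(n : ℤ) - 1))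
    rw [tr_tr, sub_add_cancel, ih] at this
    have h2 := congrArg (fun w => tr w (-D)) this
    simp only [tr_tr, add_neg_cancel, tr_zero] at h2
    rw [← h2]; congr 1; ring

theorem cov_e : IsCoveringMap (fun t : ℝ => Circle.exp (2 * Real.pi * t)) :=
  Circle.isCoveringMap_exp.comp_homeomorph (Homeomorph.mulLeft₀ (2 * Real.pi) (by positivity))

theorem nielsen_dvd {g : Ann → Ann} {G : AnnTil → AnnTil} (hG : Continuous G)
    (hl : ∀ z, pr (G z) = g (pr z)) {D : ℤ} (hD : ∀ z, G (tr z 1) = tr (G z) D)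
    {z w : AnnTil} {i j : ℤ} (hz : G z = tr z i) (hw : G w = tr w j)
    (h : NielsenEquiv g (pr z) (pr w)) : (D - 1) ∣ i - j := by
  obtain ⟨hg, hp, hq, γ, hγ⟩ := h
  let γ1 : C(unitInterval, Circle) := ⟨fun t => (γ t).1, by fun_prop⟩
  obtain ⟨Γ, hΓ, hΓ0⟩ := cov_e.exists_path_lifts γ1 z.1
    (by simp only [γ1, ContinuousMap.coe_mk, Path.source]; rfl)
  let zt : unitInterval → AnnTil := fun t => (Γ t, (γ t).2)
  have hzt : Continuous zt := by fun_prop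
  have hpz : ∀ t, pr (zt t) = γ t := fun t => Prod.ext (congrFun hΓ t) rfl
  have hz0 : zt 0 = z := Prod.ext hΓ0 (by simp only [zt, Path.source]; rfl)
  obtain ⟨m, hm⟩ : ∃ m : ℤ, zt 1 = tr w m := pr_eq (by rw [hpz]; simp)
  let Γ0 : C(unitInterval, ℝ) := ⟨fun t => Γ t + i, by fun_prop⟩
  let Γ1 : C(unitInterval, ℝ) := ⟨fun t => (G (zt t)).1, by fun_prop⟩
  have h0 : Γ0 0 = Γ1 0 := by
    simp only [Γ0, Γ1, ContinuousMap.coe_mk]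
    rw [hz0, hz, hΓ0]; rfl
  have hom : Γ0.HomotopicRel Γ1 {0, 1} := by
    rw [cov_e.homotopicRel_iff_comp ⟨0, by simp, h0⟩]
    have := Nonempty.map (fun H => ContinuousMap.HomotopyRel.compContinuousMap H
      (⟨Prod.fst, continuous_fst⟩ : C(Ann, Circle))) hγ
    change ContinuousMap.HomotopicRel _ _ _ at this
    convert this using 1
    · ext t
      have := congrArg (fun q => (Prod.fst q : Circle)) ((pr_tr (zt t) i).trans (hpz t))
      exact congrArg Subtype.val this
    · ext t
      have := congrArg (fun q => (Prod.fst q : Circle)) ((hl (zt t)).trans (congrArg g (hpz t)))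
      exact congrArg Subtype.val this
  have h1 : Γ0 1 = Γ1 1 := by
    obtain ⟨H⟩ := hom
    rw [← H.eq_fst 0 (x := 1) (by simp), ← H.eq_snd 0 (x := 1) (by simp)]
  simp only [Γ0, Γ1, ContinuousMap.coe_mk] at h1
  have h2 : Γ 1 = w.1 + m := congrArg Prod.fst hm
  rw [hm, deg_int hD, hw, tr_tr, h2] at h1
  simp only [tr] at h1
  have h3 : (m : ℝ) + i = ((j + D * m : ℤ) : ℝ) := by linarith
  have h4 : m + i = j + D * m := by exact_mod_cast h3
  exact ⟨m, by linarith⟩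

theorem nielsen_of_eq {g : Ann → Ann} (hg : Continuous g) {G : AnnTil → AnnTil} (hG : Continuous G)
    (hl : ∀ z, pr (G z) = g (pr z)) {z w : AnnTil} {i : ℤ} (hz : G z = tr z i) (hw : G w = tr w i) :
    NielsenEquiv g (pr z) (pr w) := by
  have : ContractibleSpace (Ioo (0:ℝ) 1) :=
    (convex_Ioo (0:ℝ) 1).contractibleSpace ⟨1/2, by norm_num⟩
  let Γ : Path z w := PathConnectedSpace.somePath z w
  have hc := continuous_tr (-i)
  let Γ' : Path z w := ⟨⟨fun t => tr (G (Γ t)) (-i), hc.comp (hG.comp Γ.continuous)⟩,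
    by simp [hz, tr_tr, tr_zero], by simp [hw, tr_tr, tr_zero]⟩
  have hom : Γ.Homotopic Γ' := SimplyConnectedSpace.paths_homotopic Γ Γ'
  refine ⟨hg, by rw [← hl, hz, pr_tr], by rw [← hl, hw, pr_tr], Γ.map continuous_pr, ?_⟩
  have h2 := hom.map ⟨pr, continuous_pr⟩
  refine (congrArg (Path.Homotopic (Γ.map continuous_pr)) (Path.ext (funext fun t => ?_))).mp h2
  change pr (tr (G (Γ t)) (-i)) = g (pr (Γ t))
  rw [pr_tr, hl]

theorem nielsen_count {g : Ann → Ann} (hg : Continuous g) {G : AnnTil → AnnTil} (hG : Continuous G)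
    (hl : ∀ z, pr (G z) = g (pr z)) {D : ℤ} (hD : ∀ z, G (tr z 1) = tr (G z) D) (hD1 : D ≠ 1)
    (hfix : ∀ k : ℤ, ∃ z, G z = tr z k) : HasExactlyNielsenClasses g (D - 1).natAbs := by
  classical
  choose z hz using hfix
  have hfp : ∀ k, g (pr (z k)) = pr (z k) := fun k => by rw [← hl, hz, pr_tr]
  have uniq : ∀ i < (D - 1).natAbs, ∀ j < (D - 1).natAbs,
      NielsenEquiv g (pr (z (i : ℕ))) (pr (z (j : ℕ))) → i = j := by
    intro i hi j hj h
    have h1 := nielsen_dvd hG hl hD (hz i) (hz j) h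
    have h2 : ((i : ℤ) - j) = 0 := by
      apply Int.eq_zero_of_abs_lt_dvd ((abs_dvd _ _).2 h1)
      rw [Int.abs_eq_natAbs (D - 1), abs_lt]; omega
    omega
  refine ⟨(Finset.range (D - 1).natAbs).image (fun i : ℕ => pr (z i)), ?_, ?_, ?_, ?_⟩
  · rw [Finset.card_image_of_injOn, Finset.card_range]
    intro i hi j hj h
    simp only [Finset.coe_range, mem_Iio] at hi hj
    apply uniq i hi j hj
    simp only at h
    rw [← h]
    exact nielsen_of_eq hg hG hl (hz i) (hz i)
  · simp only [Finset.mem_image]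
    rintro p ⟨i, -, rfl⟩
    exact hfp _
  · simp only [Finset.mem_image, Finset.mem_range]
    rintro p ⟨i, hi, rfl⟩ q ⟨j, hj, rfl⟩ hne h
    exact hne (by rw [uniq i hi j hj h])
  · intro p hp
    obtain ⟨x, rfl⟩ := pr_surj p
    obtain ⟨k, hk⟩ := pr_eq (z := x) (w := G x) (by rw [hl, hp])
    have hD0 : D - 1 ≠ 0 := sub_ne_zero.2 hD1
    have hn := Int.emod_nonneg k hD0
    have hlt := Int.emod_lt_abs k hD0
    rw [Int.abs_eq_natAbs] at hlt
    have hx : G (tr x (-(k / (D - 1)))) = tr (tr x (-(k / (D - 1)))) (k % (D - 1)) := by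
      rw [deg_int hD, hk, tr_tr, tr_tr]
      congr 1
      have := Int.mul_ediv_add_emod k (D - 1)
      linarith
    refine ⟨pr (z (k % (D - 1))), ?_, ?_⟩
    · simp only [Finset.mem_image, Finset.mem_range]
      refine ⟨(k % (D - 1)).toNat, by omega, ?_⟩
      rw [Int.toNat_of_nonneg hn]
    · rw [← pr_tr x (-(k / (D - 1)))]
      exact nielsen_of_eq hg hG hl hx (hz _)

theorem fix_point {G : AnnTil → AnnTil} (hG : Continuous G) {D : ℤ}
    (hD : ∀ z, G (tr z 1) = tr (G z) D) (hD1 : D ≠ 1) {ε : ℝ} (hε : ε ∈ Set.Ioo (0:ℝ) (1/2))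
    (h2 : (∀ z : AnnTil, ((z.2 : ℝ) = ε → ((G z).2 : ℝ) < ε) ∧
        ((z.2 : ℝ) = 1 - ε → 1 - ε < ((G z).2 : ℝ))) ∨
      (∀ z : AnnTil, ((z.2 : ℝ) = ε → 1 - ε < ((G z).2 : ℝ)) ∧
        ((z.2 : ℝ) = 1 - ε → ((G z).2 : ℝ) < ε))) : ∃ z, G z = z := by
  obtain ⟨he0, he1⟩ := hε
  have hle : ε ≤ 1 - ε := by linarith
  let Y : ℝ → Ioo (0:ℝ) 1 := fun y => ⟨projIcc ε (1 - ε) hle y, by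
    have := (projIcc ε (1 - ε) hle y).2
    exact ⟨by linarith [this.1], by linarith [this.2]⟩⟩
  have hY : Continuous Y := by
    have := continuous_projIcc (h := hle)
    fun_prop
  have hYe : ∀ y ∈ Icc ε (1 - ε), (Y y : ℝ) = y := fun y hy => by
    simp only [Y, projIcc_of_mem hle hy]
  let φ : ℝ × ℝ → ℝ := fun z => (G (z.1, Y z.2)).1 - D * z.1
  have hφ : Continuous φ := by fun_prop
  have hper : ∀ y, Function.Periodic (fun x => φ (x, y)) 1 := fun y x => by
    have := congrArg Prod.fst (hD (x, Y y))
    simp only [tr, Int.cast_one] at this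
    simp only [φ, this]; ring
  obtain ⟨B, hB⟩ := (isCompact_Icc.prod isCompact_Icc : IsCompact (Icc (0:ℝ) 1 ×ˢ Icc ε (1 - ε))).exists_bound_of_continuousOn
    hφ.continuousOn
  have hB' : ∀ x, ∀ y ∈ Icc ε (1 - ε), |φ (x, y)| ≤ B := fun x y hy => by
    obtain ⟨x', hx', he⟩ := (hper y).exists_mem_Ico₀ one_pos x
    rw [show φ (x, y) = φ (x', y) from he]
    exact hB (x', y) ⟨⟨hx'.1, hx'.2.le⟩, hy⟩
  have hB0 : 0 ≤ B := (abs_nonneg _).trans (hB' 0 ε ⟨le_rfl, hle⟩)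
  let u : ℝ × ℝ → ℝ := fun z => (G (z.1, Y z.2)).1 - z.1
  let v : ℝ × ℝ → ℝ := fun z => ((G (z.1, Y z.2)).2 : ℝ) - z.2
  have hu : ∀ x y, u (x, y) = φ (x, y) + (D - 1) * x := fun x y => by simp only [u, φ]; ring
  have H1 : (∀ y ∈ Icc ε (1 - ε), u (-(B + 1), y) < 0 ∧ 0 < u (B + 1, y)) ∨
      (∀ y ∈ Icc ε (1 - ε), 0 < u (-(B + 1), y) ∧ u (B + 1, y) < 0) := by
    rcases lt_or_gt_of_ne hD1 with h | h
    · right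
      have h' : (D : ℝ) - 1 ≤ -1 := by
        have : D - 1 ≤ -1 := by omega
        exact_mod_cast this
      intro y hy
      have b1 := abs_le.1 (hB' (-(B + 1)) y hy)
      have b2 := abs_le.1 (hB' (B + 1) y hy)
      constructor <;> rw [hu] <;> nlinarith
    · left
      have h' : 1 ≤ (D : ℝ) - 1 := by
        have : 1 ≤ D - 1 := by omega
        exact_mod_cast this
      intro y hy
      have b1 := abs_le.1 (hB' (-(B + 1)) y hy)
      have b2 := abs_le.1 (hB' (B + 1) y hy)
      constructor <;> rw [hu] <;> nlinarith
  have H2 : (∀ x ∈ Icc (-(B + 1)) (B + 1), v (x, ε) < 0 ∧ 0 < v (x, 1 - ε)) ∨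
      (∀ x ∈ Icc (-(B + 1)) (B + 1), 0 < v (x, ε) ∧ v (x, 1 - ε) < 0) := by
    have c0 := hYe ε ⟨le_rfl, hle⟩
    have c1 := hYe (1 - ε) ⟨hle, le_rfl⟩
    rcases h2 with h | h
    · left
      intro x _
      have d0 := (h (x, Y ε)).1 c0
      have d1 := (h (x, Y (1 - ε))).2 c1
      constructor <;> simp only [v] <;> linarith
    · right
      intro x _
      have d0 := (h (x, Y ε)).1 c0
      have d1 := (h (x, Y (1 - ε))).2 c1
      constructor <;> simp only [v] <;> linarith
  obtain ⟨⟨x, y⟩, ⟨-, hy⟩, hux, hvx⟩ := miranda' u v (by fun_prop) (by fun_prop)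
    (a := -(B + 1)) (b := B + 1) (c := ε) (d := 1 - ε) (by linarith) hle H1 H2
  refine ⟨(x, Y y), Prod.ext ?_ (Subtype.ext ?_)⟩
  · simp only [u] at hux; simp only; linarith
  · simp only [v] at hvx; have := hYe y hy; simp only at this ⊢; linarith

theorem ends_perm {g : Ann → Ann} (hg : Continuous g) (hs : Function.Surjective g)
    {ε : ℝ} (hε : ε ∈ Set.Ioo (0:ℝ) (1/2))
    (hattr : closure (g '' {p : Ann | (p.2 : ℝ) < ε ∨ 1 - ε < (p.2 : ℝ)})
      ⊆ {p : Ann | (p.2 : ℝ) < ε ∨ 1 - ε < (p.2 : ℝ)}) :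
    (∀ p : Ann, ((p.2 : ℝ) ≤ ε → ((g p).2 : ℝ) < ε) ∧
        (1 - ε ≤ (p.2 : ℝ) → 1 - ε < ((g p).2 : ℝ))) ∨
      (∀ p : Ann, ((p.2 : ℝ) ≤ ε → 1 - ε < ((g p).2 : ℝ)) ∧
        (1 - ε ≤ (p.2 : ℝ) → ((g p).2 : ℝ) < ε)) := by
  obtain ⟨he0, he1⟩ := hε
  let e0 : Ioo (0:ℝ) 1 := ⟨ε, he0, by linarith⟩
  let e1 : Ioo (0:ℝ) 1 := ⟨1 - ε, by linarith, by linarith⟩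
  have hcl0 : ∀ p : Ann, (p.2 : ℝ) ≤ ε → p ∈ closure {p : Ann | (p.2 : ℝ) < ε ∨ 1 - ε < (p.2 : ℝ)} := by
    intro p hp
    have : p ∈ closure ((univ : Set Circle) ×ˢ Iio e0) := by
      rw [closure_prod_eq, closure_univ, closure_Iio' ⟨⟨ε / 2, by linarith, by linarith⟩, by
        show (_ : ℝ) < ε
        simp only; linarith⟩]
      exact ⟨trivial, hp⟩
    exact closure_mono (fun q hq => Or.inl hq.2) this
  have hcl1 : ∀ p : Ann, 1 - ε ≤ (p.2 : ℝ) → p ∈ closure {p : Ann | (p.2 : ℝ) < ε ∨ 1 - ε < (p.2 : ℝ)} := by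
    intro p hp
    have : p ∈ closure ((univ : Set Circle) ×ˢ Ioi e1) := by
      rw [closure_prod_eq, closure_univ, closure_Ioi' ⟨⟨1 - ε / 2, by linarith, by linarith⟩, by
        show 1 - ε < (_ : ℝ)
        simp only; linarith⟩]
      exact ⟨trivial, hp⟩
    exact closure_mono (fun q hq => Or.inr hq.2) this
  have hU : ∀ p ∈ closure {p : Ann | (p.2 : ℝ) < ε ∨ 1 - ε < (p.2 : ℝ)},
      ((g p).2 : ℝ) < ε ∨ 1 - ε < ((g p).2 : ℝ) := fun p hp =>
    hattr (image_closure_subset_closure_image hg ⟨p, hp, rfl⟩)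
  have key : ∀ C : Set Ann, IsPreconnected C →
      (∀ p ∈ C, ((g p).2 : ℝ) < ε ∨ 1 - ε < ((g p).2 : ℝ)) →
      (∀ p ∈ C, ((g p).2 : ℝ) < ε) ∨ (∀ p ∈ C, 1 - ε < ((g p).2 : ℝ)) := by
    intro C hC h
    by_contra hcon
    push Not at hcon
    obtain ⟨⟨p, hp, hp'⟩, ⟨q, hq, hq'⟩⟩ := hcon
    have hc : Continuous fun p : Ann => ((g p).2 : ℝ) := by fun_prop
    obtain ⟨x, hx, hxe⟩ := hC.intermediate_value hq hp hc.continuousOn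
      (show (1/2 : ℝ) ∈ Icc _ _ from by
        have := h p hp
        have := h q hq
        constructor <;> grind)
    have := h x hx
    simp only at hxe
    rw [hxe] at this
    rcases this with h | h <;> linarith
  have pc0 : IsPreconnected {p : Ann | (p.2 : ℝ) ≤ ε} := by
    have h1 : IsPreconnected {y : Ioo (0:ℝ) 1 | (y : ℝ) ≤ ε} := by
      rw [← Topology.IsInducing.subtypeVal.isPreconnected_image]
      convert isPreconnected_Ioc (a := (0:ℝ)) (b := ε) using 1
      ext y
      simp only [mem_image, mem_ofPred_eq, Subtype.exists, exists_and_right, exists_eq_right, mem_Ioc,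
        mem_Ioo]
      grind
    convert (isPreconnected_univ (α := Circle)).prod h1 using 1
    ext p; simp
  have pc1 : IsPreconnected {p : Ann | 1 - ε ≤ (p.2 : ℝ)} := by
    have h1 : IsPreconnected {y : Ioo (0:ℝ) 1 | 1 - ε ≤ (y : ℝ)} := by
      rw [← Topology.IsInducing.subtypeVal.isPreconnected_image]
      convert isPreconnected_Ico (a := 1 - ε) (b := (1:ℝ)) using 1
      ext y
      simp only [mem_image, mem_ofPred_eq, Subtype.exists, exists_and_right, exists_eq_right, mem_Ico,
        mem_Ioo]
      grind
    convert (isPreconnected_univ (α := Circle)).prod h1 using 1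
    ext p; simp
  have hK : IsCompact {p : Ann | ε ≤ (p.2 : ℝ) ∧ (p.2 : ℝ) ≤ 1 - ε} := by
    have h1 : IsCompact {y : Ioo (0:ℝ) 1 | ε ≤ (y : ℝ) ∧ (y : ℝ) ≤ 1 - ε} := by
      rw [Topology.IsInducing.subtypeVal.isCompact_iff]
      convert isCompact_Icc (a := ε) (b := 1 - ε) using 1
      ext y
      simp only [mem_image, mem_ofPred_eq, Subtype.exists, exists_and_right, exists_eq_right, mem_Icc,
        mem_Ioo]
      grind
    convert (isCompact_univ (X := Circle)).prod h1 using 1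
    ext p; simp
  have hKne : {p : Ann | ε ≤ (p.2 : ℝ) ∧ (p.2 : ℝ) ≤ 1 - ε}.Nonempty :=
    ⟨(1, e0), le_rfl, by show ε ≤ 1 - ε; linarith⟩
  have hc : Continuous fun p : Ann => ((g p).2 : ℝ) := by fun_prop
  obtain ⟨pM, -, hM⟩ := hK.exists_isMaxOn hKne hc.continuousOn
  obtain ⟨pm, -, hm⟩ := hK.exists_isMinOn hKne hc.continuousOn
  rcases key _ pc0 (fun p hp => hU p (hcl0 p hp)) with k0 | k0 <;>
    rcases key _ pc1 (fun p hp => hU p (hcl1 p hp)) with k1 | k1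
  · exfalso
    obtain ⟨y, hy1, hy2⟩ := exists_between (max_lt (g pM).2.2.2 (show 1 - ε < 1 by linarith))
    have hyM := (le_max_left _ _).trans_lt hy1
    have hye := (le_max_right _ _).trans_lt hy1
    obtain ⟨p, hp⟩ := hs (1, ⟨y, by linarith, hy2⟩)
    have hpy : ((g p).2 : ℝ) = y := by rw [hp]
    by_cases h0 : (p.2 : ℝ) ≤ ε
    · have : ((g p).2 : ℝ) < ε := k0 p h0
      linarith
    by_cases h1 : 1 - ε ≤ (p.2 : ℝ)
    · have : ((g p).2 : ℝ) < ε := k1 p h1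
      linarith
    have : ((g p).2 : ℝ) ≤ (g pM).2 := hM (show ε ≤ (p.2 : ℝ) ∧ (p.2 : ℝ) ≤ 1 - ε by grind)
    linarith
  · exact Or.inl fun p => ⟨k0 p, k1 p⟩
  · exact Or.inr fun p => ⟨k0 p, k1 p⟩
  · exfalso
    obtain ⟨y, hy1, hy2⟩ := exists_between (lt_min (g pm).2.2.1 he0)
    have hyM := hy2.trans_le (min_le_left _ _)
    have hye := hy2.trans_le (min_le_right _ _)
    obtain ⟨p, hp⟩ := hs (1, ⟨y, hy1, by linarith⟩)
    have hpy : ((g p).2 : ℝ) = y := by rw [hp]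
    by_cases h0 : (p.2 : ℝ) ≤ ε
    · have : 1 - ε < ((g p).2 : ℝ) := k0 p h0
      linarith
    by_cases h1 : 1 - ε ≤ (p.2 : ℝ)
    · have : 1 - ε < ((g p).2 : ℝ) := k1 p h1
      linarith
    have : ((g pm).2 : ℝ) ≤ (g p).2 := hm (show ε ≤ (p.2 : ℝ) ∧ (p.2 : ℝ) ≤ 1 - ε by grind)
    linarith

theorem cov_surj {f : Ann → Ann} (hcov : IsCoveringMap f) : Function.Surjective f := by
  intro y
  obtain ⟨x0⟩ : Nonempty Ann := ⟨(1, ⟨1/2, by norm_num⟩)⟩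
  have : ContractibleSpace (Ioo (0:ℝ) 1) :=
    (convex_Ioo (0:ℝ) 1).contractibleSpace ⟨1/2, by norm_num⟩
  obtain ⟨z, hz⟩ := pr_surj (f x0)
  obtain ⟨w, hw⟩ := pr_surj y
  let γ : Path (f x0) y := ((PathConnectedSpace.somePath z w).map continuous_pr).cast hz.symm hw.symm
  obtain ⟨Γ, hΓ, -⟩ := hcov.exists_path_lifts γ x0 (by simp)
  exact ⟨Γ 1, (congrFun hΓ 1).trans (by simp)⟩

/-- If each end of the annulus is attracting, then `f` is complete. -/
theorem stmt_17 (f : Ann → Ann) (d : ℤ) (hcov : IsCoveringMap f)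
    (hdeg : HasDegree f d) (hd : 1 < |d|)
    (ε : ℝ) (hε : ε ∈ Set.Ioo (0:ℝ) (1/2))
    (hattr : closure (f '' {p : Ann | (p.2 : ℝ) < ε ∨ 1 - ε < (p.2 : ℝ)})
      ⊆ {p : Ann | (p.2 : ℝ) < ε ∨ 1 - ε < (p.2 : ℝ)}) :
    ∀ n : ℕ, 1 ≤ n →
      HasExactlyNielsenClasses (f^[n]) (d ^ n - 1).natAbs := by
  intro n hn
  obtain ⟨F, ⟨hF, hlift⟩, hFd⟩ := hdeg
  have hfc := hcov.continuous
  have hgc : Continuous f^[n] := hfc.iterate n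
  have hGc : Continuous F^[n] := hF.iterate n
  have hl : ∀ z, pr (F^[n] z) = f^[n] (pr z) := fun z =>
    Function.Semiconj.iterate_right (f := pr) (ga := F) (gb := f) (congrFun hlift) n z
  have hGd : ∀ m : ℕ, ∀ z, F^[m] (tr z 1) = tr (F^[m] z) (d ^ m) := by
    intro m
    induction m with
    | zero => intro z; simp
    | succ m ih =>
      intro z
      rw [Function.iterate_succ_apply', ih, deg_int hFd, Function.iterate_succ_apply']
      congr 1; ring
  have hd1 : d ^ n ≠ 1 := by
    intro h
    have h1 : |d| ^ n = 1 := by rw [← abs_pow, h, abs_one]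
    have h2 := one_lt_pow₀ hd (by omega : n ≠ 0)
    omega
  have hs : Function.Surjective f^[n] := (cov_surj hcov).iterate n
  have hmaps : MapsTo f {p : Ann | (p.2 : ℝ) < ε ∨ 1 - ε < (p.2 : ℝ)}
      {p : Ann | (p.2 : ℝ) < ε ∨ 1 - ε < (p.2 : ℝ)} := fun p hp =>
    hattr (subset_closure ⟨p, hp, rfl⟩)
  have hattr' : closure (f^[n] '' {p : Ann | (p.2 : ℝ) < ε ∨ 1 - ε < (p.2 : ℝ)})
      ⊆ {p : Ann | (p.2 : ℝ) < ε ∨ 1 - ε < (p.2 : ℝ)} := by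
    refine (closure_mono ?_).trans hattr
    rintro _ ⟨p, hp, rfl⟩
    obtain ⟨m, rfl⟩ := Nat.exists_eq_add_of_le' hn
    rw [Function.iterate_succ_apply']
    exact ⟨_, hmaps.iterate m hp, rfl⟩
  have hends := ends_perm hgc hs hε hattr'
  refine nielsen_count hgc hGc hl (hGd n) hd1 fun k => ?_
  have hsnd : ∀ z, (F^[n] z).2 = (f^[n] (pr z)).2 := fun z => congrArg Prod.snd (hl z)
  obtain ⟨z, hz⟩ := fix_point (G := fun z => tr (F^[n] z) (-k)) ((continuous_tr _).comp hGc)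
    (D := d ^ n) (fun z => by rw [hGd n, tr_tr, tr_tr, add_comm]) hd1 hε (by
      rcases hends with h | h
      · left
        intro z
        simp only [tr, hsnd]
        exact ⟨fun hz => (h (pr z)).1 hz.le, fun hz => (h (pr z)).2 hz.ge⟩
      · right
        intro z
        simp only [tr, hsnd]
        exact ⟨fun hz => (h (pr z)).1 hz.le, fun hz => (h (pr z)).2 hz.ge⟩)
  refine ⟨z, ?_⟩
  have h2 := congrArg (fun w => tr w k) hz
  simpa [tr_tr, tr_zero] using h2
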